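/- Let P be a nonconstant complex polynomial in two variables of total degree d, and suppose that the set S = {(x, y) ∈ ℝ² : P(x, iy) = 0} is finite. Then S has at most d² elements. -/

import Mathlib

namespace MvPolynomial

theorem two_mul_finrank_restrictTotalDegree_fin_two (K : Type*) [Field K] (n : ℕ) :
    2 * Module.finrank K (restrictTotalDegree (Fin 2) K n) = (n + 1) * (n + 2) := by
  classical
  have hset : {m : Fin 2 →₀ ℕ | (m.sum fun _ e ↦ e) ≤ n} =
      ↑((Finset.range (n + 1)).biUnion fun k ↦ Finset.univ.finsuppAntidiag k : Finset (Fin 2 →₀ ℕ)) := by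
    ext m
    simp [Finsupp.sum_fintype]
  have hcard : Module.finrank K (restrictTotalDegree (Fin 2) K n) =
      ∑ k ∈ Finset.range (n + 1), (k + 1) := by
    rw [restrictTotalDegree, Module.finrank_eq_nat_card_basis (basisRestrictSupport K _), hset,
      Nat.card_coe_set_eq, Set.ncard_coe_finset, Finset.card_biUnion]
    · refine Finset.sum_congr rfl fun k _ ↦ ?_
      simp [Finset.card_finsuppAntidiag_nat_eq_choose, Nat.add_comm 1 k]
    · intro i _ j _ hij
      simp only [Function.onFun, Finset.disjoint_left, Finset.mem_finsuppAntidiag']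
      rintro a ⟨rfl, _⟩ ⟨h, _⟩
      exact hij h
  rw [hcard]
  clear hset hcard
  induction n with
  | zero => rfl
  | succ n ih => rw [Finset.sum_range_succ, mul_add, ih]; ring

section Interpolation

variable {σ K : Type*} [Field K]

theorem exists_totalDegree_le_eval_eq_one_of_notMem (S : Finset (σ → K)) {t : σ → K}
    (ht : t ∉ S) :
    ∃ L : MvPolynomial σ K, L.totalDegree ≤ S.card ∧ eval t L = 1 ∧ ∀ s ∈ S, eval s L = 0 := by
  classical
  induction S using Finset.induction_on with
  | empty => exact ⟨1, by simp⟩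
  | insert q S hq ih =>
    rw [Finset.mem_insert, not_or] at ht
    obtain ⟨L, hdeg, hone, hzero⟩ := ih ht.2
    obtain ⟨j, hj⟩ := Function.ne_iff.mp ht.1
    have hj' : t j - q j ≠ 0 := sub_ne_zero.mpr hj
    refine ⟨C (t j - q j)⁻¹ * (X j - C (q j)) * L, ?_, ?_, ?_⟩
    · rw [Finset.card_insert_of_notMem hq, add_comm]
      refine (totalDegree_mul _ _).trans (add_le_add ?_ hdeg)
      refine (totalDegree_mul _ _).trans ?_
      rw [totalDegree_C, zero_add]
      exact (totalDegree_sub_C_le _ _).trans (totalDegree_X j).le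
    · simp [hone, hj']
    · intro s hs
      rcases Finset.mem_insert.mp hs with rfl | hs
      · simp
      · simp [hzero s hs]

/-- Evaluation of polynomials at the points of a finite set, as a linear map. -/
noncomputable def evalOn (T : Finset (σ → K)) : MvPolynomial σ K →ₗ[K] (T → K) :=
  LinearMap.pi fun t ↦ (aeval t.1).toLinearMap

@[simp]
theorem evalOn_apply (T : Finset (σ → K)) (p : MvPolynomial σ K) (t : T) :
    evalOn T p t = eval t.1 p := by
  simp [evalOn, aeval_eq_eval]

theorem surjective_evalOn_domRestrict (T : Finset (σ → K)) {n : ℕ} (hn : T.card ≤ n) :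
    Function.Surjective ((evalOn T).domRestrict (restrictTotalDegree σ K n)) := by
  classical
  intro g
  choose L hdeg hone hzero using fun t : T ↦
    exists_totalDegree_le_eval_eq_one_of_notMem (T.erase t.1) (Finset.notMem_erase t.1 T)
  have hmem (t : T) : L t ∈ restrictTotalDegree σ K n :=
    (mem_restrictTotalDegree _ _ _).mpr
      ((hdeg t).trans ((Finset.card_le_card (Finset.erase_subset _ _)).trans hn))
  refine ⟨⟨∑ t, g t • L t, Submodule.sum_mem _ fun t _ ↦ Submodule.smul_mem _ _ (hmem t)⟩, ?_⟩
  ext s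
  rw [LinearMap.domRestrict_apply, evalOn_apply, map_sum, Finset.sum_eq_single s]
  · simp [hone, smul_eval]
  · intro t _ hts
    have : eval s.1 (L t) = 0 :=
      hzero t s.1 (Finset.mem_erase.mpr ⟨fun h ↦ hts (Subtype.ext h.symm), s.2⟩)
    simp [this, smul_eval]
  · simp

end Interpolation

/-- A weak form of Bézout's theorem in the affine plane. -/
theorem card_common_zeros_le_totalDegree_mul_totalDegree {K : Type*} [Field K]
    {A B : MvPolynomial (Fin 2) K} (hA : Irreducible A) (hAB : ¬ A ∣ B) (T : Finset (Fin 2 → K))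
    (hTA : ∀ t ∈ T, eval t A = 0) (hTB : ∀ t ∈ T, eval t B = 0) :
    T.card ≤ A.totalDegree * B.totalDegree := by
  have hA0 : A ≠ 0 := hA.ne_zero
  have hB0 : B ≠ 0 := by rintro rfl; exact hAB (dvd_zero A)
  set a := A.totalDegree with ha
  set b := B.totalDegree with hb
  set N := T.card with hN
  let V (n : ℕ) : Submodule K (MvPolynomial (Fin 2) K) := restrictTotalDegree (Fin 2) K n
  let U₁ := (V (N + b)).map (LinearMap.mulLeft K A)
  let U₂ := (V (N + a)).map (LinearMap.mulLeft K B)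
  have hU₁ : Module.finrank K U₁ = Module.finrank K (V (N + b)) :=
    (Submodule.equivMapOfInjective _ (mul_right_injective₀ hA0) _).finrank_eq.symm
  have hU₂ : Module.finrank K U₂ = Module.finrank K (V (N + a)) :=
    (Submodule.equivMapOfInjective _ (mul_right_injective₀ hB0) _).finrank_eq.symm
  have hinf : Module.finrank K ↥(U₁ ⊓ U₂) ≤ Module.finrank K (V N) := by
    have hle : U₁ ⊓ U₂ ≤ (V N).map (LinearMap.mulLeft K (B * A)) := by
      rintro _ ⟨⟨u, _, rfl⟩, ⟨v, hv, huv⟩⟩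
      simp only [LinearMap.mulLeft_apply] at huv ⊢
      obtain ⟨w, rfl⟩ : A ∣ v :=
        (hA.prime.dvd_or_dvd (Dvd.intro u huv.symm)).resolve_left hAB
      refine ⟨w, ?_, by simp [← huv]⟩
      rcases eq_or_ne w 0 with rfl | hw
      · exact Submodule.zero_mem _
      · have := (mem_restrictTotalDegree _ _ _).mp hv
        rw [totalDegree_mul_of_isDomain hA0 hw] at this
        exact (mem_restrictTotalDegree _ _ _).mpr (by omega)
    exact (Submodule.finrank_mono hle).trans (Submodule.finrank_map_le _ _)
  have hU₁V : U₁ ≤ V (N + a + b) := by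
    rintro _ ⟨u, hu, rfl⟩
    have := (mem_restrictTotalDegree _ _ _).mp hu
    exact (mem_restrictTotalDegree _ _ _).mpr ((totalDegree_mul _ _).trans (by omega))
  have hU₂V : U₂ ≤ V (N + a + b) := by
    rintro _ ⟨u, hu, rfl⟩
    have := (mem_restrictTotalDegree _ _ _).mp hu
    exact (mem_restrictTotalDegree _ _ _).mpr ((totalDegree_mul _ _).trans (by omega))
  let ε := (evalOn T).domRestrict (V (N + a + b))
  have hker : (U₁ ⊔ U₂).comap (V (N + a + b)).subtype ≤ LinearMap.ker ε := by
    have : U₁ ⊔ U₂ ≤ LinearMap.ker (evalOn T) := by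
      refine sup_le ?_ ?_
      · rintro _ ⟨u, _, rfl⟩
        ext t
        simp [hTA t.1 t.2]
      · rintro _ ⟨u, _, rfl⟩
        ext t
        simp [hTB t.1 t.2]
    intro x hx
    exact this hx
  have hsup : Module.finrank K ↥(U₁ ⊔ U₂) ≤ Module.finrank K (LinearMap.ker ε) := by
    rw [← (Submodule.comapSubtypeEquivOfLe (sup_le hU₁V hU₂V)).finrank_eq]
    exact Submodule.finrank_mono hker
  have hrank : N + Module.finrank K (LinearMap.ker ε) = Module.finrank K (V (N + a + b)) := by
    rw [← LinearMap.finrank_range_add_finrank_ker ε,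
      LinearMap.range_eq_top.mpr (surjective_evalOn_domRestrict T (by omega))]
    simp [hN]
  have hsum := Submodule.finrank_sup_add_finrank_inf_eq U₁ U₂
  have h₀ := two_mul_finrank_restrictTotalDegree_fin_two K N
  have h₁ := two_mul_finrank_restrictTotalDegree_fin_two K (N + b)
  have h₂ := two_mul_finrank_restrictTotalDegree_fin_two K (N + a)
  have h₃ := two_mul_finrank_restrictTotalDegree_fin_two K (N + a + b)
  simp only [V] at *
  nlinarith

theorem totalDegree_pderiv_le {σ R : Type*} [CommSemiring R] (i : σ) (p : MvPolynomial σ R) :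
    (pderiv i p).totalDegree ≤ p.totalDegree - 1 := by
  refine Finset.sup_le fun m hm ↦ ?_
  rw [mem_support_iff, coeff_pderiv] at hm
  have h := le_totalDegree (mem_support_iff.mpr (left_ne_zero_of_mul hm))
  rw [Finsupp.sum_add_index' (fun _ ↦ rfl) (fun _ _ _ ↦ rfl), Finsupp.sum_single_index rfl] at h
  omega

theorem totalDegree_eq_zero_of_pderiv_eq_zero {σ R : Type*} [CommSemiring R] [CharZero R]
    [NoZeroDivisors R] {p : MvPolynomial σ R} (h : ∀ i, pderiv i p = 0) : p.totalDegree = 0 := by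
  rw [totalDegree_eq_zero_iff]
  intro m hm i
  by_contra hi
  have hc := coeff_pderiv p (i := i) (m - Finsupp.single i 1)
  rw [h i, coeff_zero, tsub_add_cancel_of_le
    (Finsupp.single_le_iff.mpr (Nat.one_le_iff_ne_zero.mpr hi)), eq_comm] at hc
  exact mul_ne_zero (mem_support_iff.mp hm) (Nat.cast_add_one_ne_zero _) hc

theorem hasDerivAt_eval_update {σ 𝕜 : Type*} [NontriviallyNormedField 𝕜] [DecidableEq σ]
    (p : MvPolynomial σ 𝕜) (x : σ → 𝕜) (i : σ) :
    HasDerivAt (fun t ↦ eval (Function.update x i t) p) (eval x (pderiv i p)) (x i) := by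
  induction p using MvPolynomial.induction_on with
  | C a => simpa using hasDerivAt_const (x i) a
  | add p q hp hq => simpa using hp.fun_add hq
  | mul_X p j hp =>
    have hX : HasDerivAt (fun t ↦ Function.update x i t j) (eval x (pderiv i (X j))) (x i) := by
      rcases eq_or_ne j i with rfl | hj
      · simpa using hasDerivAt_id' (x j)
      · simpa [hj, pderiv_X_of_ne hj] using hasDerivAt_const (x i) (x j)
    have := hp.fun_mul hX
    simp only [Function.update_eq_self] at this
    simpa [add_comm, mul_comm] using this

/-- A real polynomial in at least two variables with finitely many zeros does not change sign, so
all its zeros are critical points. -/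
theorem eval_pderiv_eq_zero_of_finite_zeros {σ : Type*} [Fintype σ] (hσ : 1 < Fintype.card σ)
    {p : MvPolynomial σ ℝ} (hp : {x | eval x p = 0}.Finite) {x : σ → ℝ} (hx : eval x p = 0)
    (i : σ) : eval x (pderiv i p) = 0 := by
  classical
  have hconn : IsPreconnected {x | eval x p = 0}ᶜ :=
    (hp.countable.isConnected_compl_of_one_lt_rank (by simpa using hσ)).isPreconnected
  have hcont : Continuous fun y ↦ eval y p := p.continuous_eval
  have hsign : (∀ y, eval y p ≤ 0) ∨ ∀ y, 0 ≤ eval y p := by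
    by_contra! ⟨⟨y, hy⟩, z, hz⟩
    obtain ⟨w, hw, hw0⟩ := hconn.intermediate_value (a := z) (b := y) hz.ne hy.ne'
      hcont.continuousOn ⟨hz.le, hy.le⟩
    exact hw hw0
  have hext : IsLocalExtr (fun t ↦ eval (Function.update x i t) p) (x i) := by
    refine hsign.symm.imp (fun h ↦ ?_) fun h ↦ ?_
    · exact Filter.Eventually.of_forall fun t ↦ by simpa [hx] using h _
    · exact Filter.Eventually.of_forall fun t ↦ by simpa [hx] using h _
  exact hext.hasDerivAt_eq_zero (hasDerivAt_eval_update p x i)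

theorem exists_map_ofReal_eq {σ : Type*} {F : MvPolynomial σ ℂ}
    (hF : map (starRingEnd ℂ) F = F) : ∃ G : MvPolynomial σ ℝ, map Complex.ofRealHom G = F := by
  refine mem_range_map_iff_coeffs_subset.mpr fun c hc ↦ ?_
  obtain ⟨m, _, rfl⟩ := mem_coeffs_iff.mp hc
  refine ⟨_, Complex.conj_eq_iff_re.mp ?_⟩
  rw [← coeff_map, hF]

theorem totalDegree_aeval_le {σ τ R : Type*} [CommSemiring R] {f : σ → MvPolynomial τ R}
    (hf : ∀ i, (f i).totalDegree ≤ 1) (p : MvPolynomial σ R) :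
    (aeval f p).totalDegree ≤ p.totalDegree := by
  rw [aeval_def, eval₂_eq]
  refine totalDegree_finsetSum_le fun m hm ↦ (totalDegree_mul _ _).trans ?_
  rw [algebraMap_eq, totalDegree_C, zero_add]
  refine (totalDegree_finsetProd _ _).trans (le_trans ?_ (le_totalDegree hm))
  exact Finset.sum_le_sum fun i _ ↦
    (totalDegree_pow _ _).trans (by simpa using Nat.mul_le_mul_left (m i) (hf i))

/-- The points with real coordinates at which a complex polynomial vanishes. -/
def realZeros {σ : Type*} (Q : MvPolynomial σ ℂ) : Set (σ → ℝ) :=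
  {x | eval (fun i ↦ (x i : ℂ)) Q = 0}

@[simp]
theorem mem_realZeros {σ : Type*} {Q : MvPolynomial σ ℂ} {x : σ → ℝ} :
    x ∈ realZeros Q ↔ eval (fun i ↦ (x i : ℂ)) Q = 0 :=
  Iff.rfl

theorem eval_map_conj {σ : Type*} (Q : MvPolynomial σ ℂ) (x : σ → ℝ) :
    eval (fun i ↦ (x i : ℂ)) (map (starRingEnd ℂ) Q) =
      starRingEnd ℂ (eval (fun i ↦ (x i : ℂ)) Q) := by
  rw [eval_map, eval₂_comp]
  congr 1
  ext i
  simp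

theorem eval_map_ofReal {σ : Type*} (G : MvPolynomial σ ℝ) (x : σ → ℝ) :
    eval (fun i ↦ (x i : ℂ)) (map Complex.ofRealHom G) = (eval x G : ℝ) := by
  rw [eval_map]
  exact (eval₂_comp Complex.ofRealHom x G).symm

theorem ncard_realZeros_le_of_not_dvd {Q B : MvPolynomial (Fin 2) ℂ} (hQ : Irreducible Q)
    (hQB : ¬ Q ∣ B) (hdeg : B.totalDegree ≤ Q.totalDegree) (hfin : (realZeros Q).Finite)
    (hB : realZeros Q ⊆ realZeros B) : (realZeros Q).ncard ≤ Q.totalDegree ^ 2 := by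
  classical
  let ι : (Fin 2 → ℝ) → Fin 2 → ℂ := fun x i ↦ x i
  have hι : Function.Injective ι := Complex.ofReal_injective.comp_left
  calc (realZeros Q).ncard = (hfin.toFinset.image ι).card := by
        rw [Finset.card_image_of_injective _ hι, Set.ncard_eq_toFinset_card _ hfin]
    _ ≤ Q.totalDegree * B.totalDegree := by
        refine card_common_zeros_le_totalDegree_mul_totalDegree hQ hQB _ ?_ ?_
        · simp [ι]
        · simpa [ι] using fun x hx ↦ hB hx
    _ ≤ Q.totalDegree ^ 2 := by
        rw [sq]
        exact Nat.mul_le_mul_left _ hdeg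

theorem ncard_realZeros_le_of_irreducible {Q : MvPolynomial (Fin 2) ℂ} (hQ : Irreducible Q)
    (hfin : (realZeros Q).Finite) : (realZeros Q).ncard ≤ Q.totalDegree ^ 2 := by
  by_cases hdvd : Q ∣ map (starRingEnd ℂ) Q
  swap
  · refine ncard_realZeros_le_of_not_dvd hQ hdvd ?_ hfin fun x hx ↦ ?_
    · exact totalDegree_le_of_support_subset (support_map_subset _ _)
    · rw [mem_realZeros] at hx ⊢
      rw [eval_map_conj, hx, map_zero]
  have hconj : map (starRingEnd ℂ) (map (starRingEnd ℂ) Q) = Q := by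
    ext m
    simp [coeff_map]
  obtain ⟨c, hc⟩ : ∃ c, map (starRingEnd ℂ) Q = C c * Q := by
    obtain ⟨R, hR⟩ := hdvd
    have hR0 : R ≠ 0 := by
      rintro rfl
      rw [hR, mul_zero, map_zero] at hconj
      exact hQ.ne_zero hconj.symm
    have hdeg : (map (starRingEnd ℂ) Q).totalDegree ≤ Q.totalDegree :=
      totalDegree_le_of_support_subset (support_map_subset _ _)
    rw [hR, totalDegree_mul_of_isDomain hQ.ne_zero hR0] at hdeg
    refine ⟨R.coeff 0, ?_⟩
    rw [hR, ← totalDegree_eq_zero_iff_eq_C.mp (by omega : R.totalDegree = 0), mul_comm]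
  obtain ⟨u, hu, huQ⟩ : ∃ u : ℂ, u ≠ 0 ∧ map (starRingEnd ℂ) (C u * Q) = C u * Q := by
    by_cases h : 1 + c = 0
    · refine ⟨Complex.I, Complex.I_ne_zero, ?_⟩
      rw [map_mul, hc, map_C, Complex.conj_I, eq_neg_of_add_eq_zero_right h]
      simp
    · refine ⟨1 + c, h, ?_⟩
      have h' : C (1 + c) * Q = Q + map (starRingEnd ℂ) Q := by
        rw [hc, C_add, C_1]
        ring
      rw [h', map_add, hconj, add_comm]
  obtain ⟨G, hG⟩ := exists_map_ofReal_eq huQ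
  have hzeros : {x | eval x G = 0} = realZeros Q := by
    ext x
    rw [Set.mem_ofPred_eq, mem_realZeros, ← Complex.ofReal_eq_zero, ← eval_map_ofReal, hG]
    simp [hu]
  obtain ⟨i, hi⟩ : ∃ i, pderiv i Q ≠ 0 := by
    by_contra! h
    have h0 := totalDegree_eq_zero_iff_eq_C.mp (totalDegree_eq_zero_of_pderiv_eq_zero h)
    refine hQ.not_isUnit (isUnit_iff_eq_C_of_isReduced.mpr ⟨_, ?_, h0⟩)
    rw [isUnit_iff_ne_zero]
    intro hc0
    rw [hc0, C_0] at h0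
    exact hQ.ne_zero h0
  have hQdeg : Q.totalDegree ≠ 0 := by
    intro h
    rw [totalDegree_eq_zero_iff_eq_C.mp h, pderiv_C] at hi
    exact hi rfl
  have hdeg := totalDegree_pderiv_le i Q
  refine ncard_realZeros_le_of_not_dvd hQ (B := pderiv i Q) (fun h ↦ ?_) (by omega) hfin ?_
  · have := totalDegree_le_of_dvd_of_isDomain h hi
    omega
  · intro x hx
    rw [← hzeros] at hfin hx
    have := eval_pderiv_eq_zero_of_finite_zeros (by simp) hfin hx i
    rw [← Complex.ofReal_eq_zero, ← eval_map_ofReal, ← pderiv_map, hG, pderiv_C_mul] at this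
    simpa [hu] using this

theorem ncard_realZeros_le {Q : MvPolynomial (Fin 2) ℂ} (hQ : Q ≠ 0)
    (hfin : (realZeros Q).Finite) : (realZeros Q).ncard ≤ Q.totalDegree ^ 2 := by
  induction Q using WfDvdMonoid.induction_on_irreducible with
  | zero => exact absurd rfl hQ
  | unit u hu =>
    have : realZeros u = ∅ := Set.eq_empty_of_forall_notMem fun x hx ↦
      (hu.map (eval fun i ↦ (x i : ℂ))).ne_zero hx
    simp [this]
  | mul a i ha hi ih =>
    have hunion : realZeros (i * a) = realZeros i ∪ realZeros a := by
      ext x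
      simp
    rw [hunion] at hfin ⊢
    have h₁ := ncard_realZeros_le_of_irreducible hi (hfin.subset Set.subset_union_left)
    have h₂ := ih ha (hfin.subset Set.subset_union_right)
    have h₃ := Set.ncard_union_le (realZeros i) (realZeros a)
    rw [totalDegree_mul_of_isDomain hi.ne_zero ha]
    refine h₃.trans ((add_le_add h₁ h₂).trans ?_)
    nlinarith [Nat.zero_le (i.totalDegree * a.totalDegree)]

end MvPolynomial

/-- Bézout–Milnor–Thom bound: if `P` is a nonconstant complex polynomial in two
variables of total degree `d` and the set `S = {(x,y) ∈ ℝ² : P(x, iy) = 0}` is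
finite, then `S` has at most `d²` elements. -/
theorem card_real_zero_set_le_sq_totalDegree
    (P : MvPolynomial (Fin 2) ℂ) (d : ℕ) (hd : P.totalDegree = d)
    (hP : 0 < P.totalDegree)
    (hS : {p : ℝ × ℝ |
        MvPolynomial.eval ![(p.1 : ℂ), Complex.I * (p.2 : ℂ)] P = 0}.Finite) :
    {p : ℝ × ℝ |
        MvPolynomial.eval ![(p.1 : ℂ), Complex.I * (p.2 : ℂ)] P = 0}.ncard ≤ d ^ 2 := by
  subst hd
  let f : Fin 2 → MvPolynomial (Fin 2) ℂ :=
    ![MvPolynomial.X 0, MvPolynomial.C Complex.I * MvPolynomial.X 1]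
  have hf (i : Fin 2) : (f i).totalDegree ≤ 1 := by
    fin_cases i
    · exact (MvPolynomial.totalDegree_X _).le
    · refine (MvPolynomial.totalDegree_mul _ _).trans ?_
      simp
  let Q := MvPolynomial.aeval f P
  have hQdeg : Q.totalDegree ≤ P.totalDegree := MvPolynomial.totalDegree_aeval_le hf P
  have hzeros : {p : ℝ × ℝ |
      MvPolynomial.eval ![(p.1 : ℂ), Complex.I * (p.2 : ℂ)] P = 0} =
        (finTwoArrowEquiv ℝ).symm ⁻¹' Q.realZeros := by
    ext p
    rw [Set.mem_preimage, MvPolynomial.mem_realZeros, Set.mem_ofPred_eq]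
    have heval : MvPolynomial.eval (fun i ↦ ((finTwoArrowEquiv ℝ).symm p i : ℂ)) Q =
        MvPolynomial.eval ![(p.1 : ℂ), Complex.I * (p.2 : ℂ)] P := by
      simp only [Q, ← MvPolynomial.aeval_eq_eval]
      rw [MvPolynomial.comp_aeval_apply]
      congr 2
      ext i
      fin_cases i <;> simp [f]
    rw [heval]
  rw [hzeros] at hS ⊢
  rw [← Equiv.image_eq_preimage_symm] at hS ⊢
  rw [Set.ncard_image_of_injective _ (finTwoArrowEquiv ℝ).injective]
  have hfin : Q.realZeros.Finite := hS.of_finite_image (finTwoArrowEquiv ℝ).injective.injOn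
  have hQ : Q ≠ 0 := by
    intro h
    refine Set.infinite_univ (α := Fin 2 → ℝ) (hfin.subset fun x _ ↦ ?_)
    simp [h]
  exact (MvPolynomial.ncard_realZeros_le hQ hfin).trans (Nat.pow_le_pow_left hQdeg 2)
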